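/- (Dual iterate stability bound for PDA.) Let z = (x,u) be any saddle point of the Lagrangian L, let (p̄⁰,p⁰,u⁰) with p⁰ = p̄⁰ initialize the PDA iteration, and set z⁰ = (p⁰,u⁰). Then for every N ≥ 1 the dual iterate satisfies ‖u^N − u‖_{Γ⁻¹} ≤ 2N‖Γ^{1/2}‖δ/α + √(2V(z⁰−z)/α) + √(N e δ²/α). -/

import Mathlib

open scoped RealInnerProductSpace
open Matrix Finset

/-- L2 operator norm of a real matrix acting between Euclidean spaces. -/
noncomputable def opNorm {m n : ℕ} (M : Matrix (Fin m) (Fin n) ℝ) : ℝ :=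
  ‖LinearMap.toContinuousLinearMap (Matrix.toEuclideanLin M)‖

/-- Matrix acting on a Euclidean vector. -/
noncomputable def mApp {m n : ℕ} (M : Matrix (Fin m) (Fin n) ℝ)
    (x : EuclideanSpace ℝ (Fin n)) : EuclideanSpace ℝ (Fin m) :=
  Matrix.toEuclideanLin M x

/-- Weighted squared norm `∑ i, g i * (x i)^2` (e.g. `‖x‖²_{Σ⁻¹}` with `g = σ⁻¹`). -/
noncomputable def wNormSq {n : ℕ} (g : Fin n → ℝ) (x : EuclideanSpace ℝ (Fin n)) : ℝ :=
  ∑ i, g i * x i ^ 2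

lemma mApp_apply {m n : ℕ} (M : Matrix (Fin m) (Fin n) ℝ) (x : EuclideanSpace ℝ (Fin n))
    (i : Fin m) : mApp M x i = ∑ j, M i j * x j := by
  simp [mApp, Matrix.toLpLin_apply, Matrix.mulVec, dotProduct]

lemma mApp_sub {m n : ℕ} (M : Matrix (Fin m) (Fin n) ℝ) (x y : EuclideanSpace ℝ (Fin n)) :
    mApp M (x - y) = mApp M x - mApp M y :=
  map_sub _ x y

lemma mApp_diagonal_apply {n : ℕ} (g : Fin n → ℝ) (x : EuclideanSpace ℝ (Fin n)) (i : Fin n) :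
    mApp (Matrix.diagonal g) x i = g i * x i := by
  simp [mApp_apply, Matrix.diagonal_apply]

lemma mApp_mul {l m n : ℕ} (M : Matrix (Fin l) (Fin m) ℝ) (M' : Matrix (Fin m) (Fin n) ℝ)
    (x : EuclideanSpace ℝ (Fin n)) : mApp (M * M') x = mApp M (mApp M' x) := by
  simp [mApp, Matrix.toLpLin_apply, Matrix.mulVec_mulVec]

lemma norm_mApp_le {m n : ℕ} (M : Matrix (Fin m) (Fin n) ℝ) (x : EuclideanSpace ℝ (Fin n)) :
    ‖mApp M x‖ ≤ opNorm M * ‖x‖ :=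
  (LinearMap.toContinuousLinearMap (Matrix.toEuclideanLin M)).le_opNorm x

lemma inner_mApp_transpose {m n : ℕ} (M : Matrix (Fin m) (Fin n) ℝ)
    (u : EuclideanSpace ℝ (Fin m)) (x : EuclideanSpace ℝ (Fin n)) :
    ⟪mApp Mᵀ u, x⟫ = ⟪u, mApp M x⟫ := by
  simp only [PiLp.inner_apply, mApp_apply, RCLike.inner_apply, conj_trivial, Matrix.transpose_apply,
    Finset.mul_sum, Finset.sum_mul]
  rw [Finset.sum_comm]
  exact Finset.sum_congr rfl fun _ _ => Finset.sum_congr rfl fun _ _ => by ring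

lemma wNormSq_nonneg {n : ℕ} {g : Fin n → ℝ} (hg : ∀ i, 0 < g i)
    (x : EuclideanSpace ℝ (Fin n)) : 0 ≤ wNormSq g x :=
  Finset.sum_nonneg fun i _ => mul_nonneg (hg i).le (sq_nonneg _)

lemma two_mul_inner_diagonal_sub {n : ℕ} (g : Fin n → ℝ) (a b c : EuclideanSpace ℝ (Fin n)) :
    2 * ⟪mApp (Matrix.diagonal g) (a - c), b - c⟫
      = wNormSq g (a - c) + wNormSq g (c - b) - wNormSq g (a - b) := by
  simp only [PiLp.inner_apply, mApp_diagonal_apply, RCLike.inner_apply, conj_trivial, wNormSq,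
    Finset.mul_sum, PiLp.sub_apply, ← Finset.sum_add_distrib, ← Finset.sum_sub_distrib]
  exact Finset.sum_congr rfl fun _ _ => by ring

lemma norm_diagonal_sqrt_inv {n : ℕ} {g : Fin n → ℝ} (hg : ∀ i, 0 < g i)
    (x : EuclideanSpace ℝ (Fin n)) :
    ‖mApp (Matrix.diagonal fun i => (Real.sqrt (g i))⁻¹) x‖
      = Real.sqrt (wNormSq (fun i => (g i)⁻¹) x) := by
  rw [EuclideanSpace.norm_eq, wNormSq]
  congr 1
  refine Finset.sum_congr rfl fun i _ => ?_
  rw [mApp_diagonal_apply, Real.norm_eq_abs, sq_abs, mul_pow, inv_pow, Real.sq_sqrt (hg i).le]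

lemma mApp_diagonal_sqrt_inv {n : ℕ} {g : Fin n → ℝ} (hg : ∀ i, 0 < g i)
    (x : EuclideanSpace ℝ (Fin n)) :
    mApp (Matrix.diagonal fun i => Real.sqrt (g i))
      (mApp (Matrix.diagonal fun i => (Real.sqrt (g i))⁻¹) x) = x := by
  ext i
  have := (Real.sqrt_pos.2 (hg i)).ne'
  rw [mApp_diagonal_apply, mApp_diagonal_apply]
  field_simp

/-- Weighted Cauchy–Schwarz for the duality pairing. -/
lemma abs_inner_le_sqrt_wNormSq {n : ℕ} {g : Fin n → ℝ} (hg : ∀ i, 0 < g i)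
    (u c : EuclideanSpace ℝ (Fin n)) :
    |⟪u, c⟫| ≤ Real.sqrt (wNormSq (fun i => (g i)⁻¹) u)
      * ‖mApp (Matrix.diagonal fun i => Real.sqrt (g i)) c‖ := by
  have h := inner_mApp_transpose (Matrix.diagonal fun i => Real.sqrt (g i))
    (mApp (Matrix.diagonal fun i => (Real.sqrt (g i))⁻¹) u) c
  rw [Matrix.diagonal_transpose, mApp_diagonal_sqrt_inv hg] at h
  rw [h, ← norm_diagonal_sqrt_inv hg]
  exact abs_real_inner_le_norm _ _

lemma abs_inner_mApp_le {p d : ℕ} (A : Matrix (Fin d) (Fin p) ℝ) {σ : Fin p → ℝ} {γ : Fin d → ℝ}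
    (hσ : ∀ i, 0 < σ i) (hγ : ∀ i, 0 < γ i) (u : EuclideanSpace ℝ (Fin d))
    (w : EuclideanSpace ℝ (Fin p)) :
    |⟪u, mApp A w⟫| ≤ opNorm (Matrix.diagonal (fun i => Real.sqrt (γ i)) * A *
        Matrix.diagonal (fun j => Real.sqrt (σ j)))
      * Real.sqrt (wNormSq (fun i => (γ i)⁻¹) u) * Real.sqrt (wNormSq (fun j => (σ j)⁻¹) w) := by
  refine (abs_inner_le_sqrt_wNormSq hγ u _).trans ?_
  have h := norm_mApp_le (Matrix.diagonal (fun i => Real.sqrt (γ i)) * A *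
    Matrix.diagonal (fun j => Real.sqrt (σ j)))
    (mApp (Matrix.diagonal fun i => (Real.sqrt (σ i))⁻¹) w)
  rw [mApp_mul, mApp_mul, mApp_diagonal_sqrt_inv hσ, norm_diagonal_sqrt_inv hσ] at h
  calc _ ≤ _ := mul_le_mul_of_nonneg_left h (Real.sqrt_nonneg _)
    _ = _ := by ring

lemma le_add_sqrt_of_sq_le {t c r : ℝ} (hc : 0 ≤ c) (hr : 0 ≤ r) (h : t ^ 2 ≤ c * t + r) :
    t ≤ c + Real.sqrt r := by
  by_contra! hlt
  nlinarith [Real.sq_sqrt hr, Real.sqrt_nonneg r,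
    mul_le_mul_of_nonneg_left hlt.le (Real.sqrt_nonneg r),
    mul_nonneg hc (Real.sqrt_nonneg r)]

/-- A discrete Gronwall-type estimate with a square-root nonlinearity. -/
lemma le_of_energy_recursion {α c s : ℝ} (hα : 0 < α) (hc : 0 ≤ c) (hs : 0 ≤ s)
    {a E : ℕ → ℝ} (ha : ∀ k, 0 ≤ a k) (hE : ∀ k, E (k + 1) ≤ E k + s + 2 * c * a (k + 1))
    (haE : ∀ k, α * a k ^ 2 ≤ E k) (N : ℕ) :
    a N ≤ 2 * N * c / α + Real.sqrt (E 0 / α) + Real.sqrt (N * s / α) := by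
  obtain ⟨j, hj, hmax⟩ := Finset.exists_max_image (Finset.range (N + 1)) a ⟨0, by simp⟩
  have hjN : j ≤ N := by simpa [Nat.lt_succ_iff] using hj
  have hsum : ∀ k ≤ N, E k ≤ E 0 + k * s + k * (2 * c * a j) := by
    intro k
    induction k with
    | zero => simp
    | succ k ih =>
      intro hk
      have h1 := ih (by omega)
      have h2 := mul_le_mul_of_nonneg_left (hmax (k + 1) (by simp; omega))
        (by positivity : 0 ≤ 2 * c)
      push_cast
      linarith [hE k]
  have hjN' : (j : ℝ) ≤ N := by exact_mod_cast hjN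
  have hE0 : 0 ≤ E 0 := (mul_nonneg hα.le (sq_nonneg (a 0))).trans (haE 0)
  have h1 : (j : ℝ) * s ≤ N * s := mul_le_mul_of_nonneg_right hjN' hs
  have h2 : (j : ℝ) * (2 * c * a j) ≤ N * (2 * c * a j) :=
    mul_le_mul_of_nonneg_right hjN' (by have := ha j; positivity)
  have hq : a j ^ 2 ≤ 2 * N * c / α * a j + (E 0 / α + N * s / α) := by
    have : 2 * N * c / α * a j + (E 0 / α + N * s / α)
        = (E 0 + N * s + N * (2 * c * a j)) / α := by ring
    rw [this, le_div_iff₀ hα]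
    linarith [haE j, hsum j hjN]
  have h3 := le_add_sqrt_of_sq_le (by positivity) (by positivity) hq
  have h4 : Real.sqrt (E 0 / α + N * s / α) ≤ Real.sqrt (E 0 / α) + Real.sqrt (N * s / α) := by
    have hx : 0 ≤ E 0 / α := by positivity
    have hy : 0 ≤ N * s / α := by positivity
    refine Real.sqrt_le_iff.2 ⟨by positivity, ?_⟩
    nlinarith [Real.sq_sqrt hx, Real.sq_sqrt hy,
      mul_nonneg (Real.sqrt_nonneg (E 0 / α)) (Real.sqrt_nonneg (N * s / α))]
  linarith [hmax N (by simp)]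

theorem pda_dual_iterate_bound
    {p d m : ℕ} (hp : 0 < p) (hd : 0 < d)
    (A : Matrix (Fin d) (Fin p) ℝ)
    (b bδ : EuclideanSpace ℝ (Fin d)) (δ : ℝ) (hδ : 0 ≤ δ) (hbδ : ‖bδ - b‖ ≤ δ)
    (J : EuclideanSpace ℝ (Fin p) → ℝ) (hJ : ConvexOn ℝ Set.univ J)
    -- diagonal positive definite preconditioners Σ = diagonal σ, Γ = diagonal γ
    (σ : Fin p → ℝ) (γ : Fin d → ℝ) (hσ : ∀ i, 0 < σ i) (hγ : ∀ i, 0 < γ i)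
    -- α := 1 - ‖Γ^{1/2} A Σ^{1/2}‖² > 0
    (α : ℝ)
    (hα : α = 1 - opNorm (Matrix.diagonal (fun i => Real.sqrt (γ i)) * A *
      Matrix.diagonal (fun j => Real.sqrt (σ j))) ^ 2)
    (hαpos : 0 < α)
    -- the Lagrangian
    (L : EuclideanSpace ℝ (Fin p) → EuclideanSpace ℝ (Fin d) → ℝ)
    (hL : ∀ x u, L x u = J x + ⟪u, mApp A x - b⟫)
    -- primal solution sets with exact and noisy data
    (S Sδ : Set (EuclideanSpace ℝ (Fin p)))
    (hS : S = {z | mApp A z = b ∧ ∀ y, mApp A y = b → J z ≤ J y})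
    (hSδ : Sδ = {z | mApp A z = bδ ∧ ∀ y, mApp A y = bδ → J z ≤ J y})
    -- the activation operators and Assumption A3 (with e = max_i e_i)
    (T : Fin m → EuclideanSpace ℝ (Fin p) → EuclideanSpace ℝ (Fin p))
    (e : ℝ) (he : 0 ≤ e)
    (hTfix : ∀ i z, z ∈ Sδ → T i z = z)
    (hTstab : ∀ i (z xbar : EuclideanSpace ℝ (Fin p)), xbar ∈ S →
      wNormSq (fun j => (σ j)⁻¹) (T i z - xbar)
        ≤ wNormSq (fun j => (σ j)⁻¹) (z - xbar) + e * δ ^ 2)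
    (ε : ℕ → Fin m)
    -- the PDA iteration
    (x pp pbar : ℕ → EuclideanSpace ℝ (Fin p)) (u : ℕ → EuclideanSpace ℝ (Fin d))
    (hinit : pp 0 = pbar 0)
    (hu : ∀ k, u (k + 1) = u k + mApp (Matrix.diagonal γ) (mApp A (pbar k) - bδ))
    (hx : ∀ k (y : EuclideanSpace ℝ (Fin p)),
      J (x (k + 1)) + ⟪mApp (Matrix.diagonal fun j => (σ j)⁻¹) (pp k - x (k + 1)) -
        mApp Aᵀ (u (k + 1)), y - x (k + 1)⟫ ≤ J y)
    (hpp : ∀ k, pp (k + 1) = T (ε (k + 1)) (x (k + 1)))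
    (hpbar : ∀ k, pbar (k + 1) = pp (k + 1) + x (k + 1) - pp k)
    -- a saddle point z = (xs, us) of the Lagrangian
    (xs : EuclideanSpace ℝ (Fin p)) (us : EuclideanSpace ℝ (Fin d))
    (hsaddle : ∀ y v, L xs v ≤ L xs us ∧ L xs us ≤ L y us)
    -- V(z⁰ - z) with z⁰ = (p⁰, u⁰)
    (V0 : ℝ)
    (hV0 : V0 = wNormSq (fun j => (σ j)⁻¹) (pp 0 - xs) / 2
      + wNormSq (fun i => (γ i)⁻¹) (u 0 - us) / 2)
    -- ‖Γ^{1/2}‖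
    (gh : ℝ) (hgh : gh = opNorm (Matrix.diagonal (fun i => Real.sqrt (γ i))))
    (N : ℕ) (hN : 1 ≤ N) :
    Real.sqrt (wNormSq (fun i => (γ i)⁻¹) (u N - us))
      ≤ 2 * (N : ℝ) * gh * δ / α + Real.sqrt (2 * V0 / α)
      + Real.sqrt ((N : ℝ) * e * δ ^ 2 / α) := by
  -- the saddle point is primal feasible and optimal
  have hb : mApp A xs = b := by
    have h := (hsaddle xs (us + (mApp A xs - b))).1
    rw [hL, hL, inner_add_left] at h
    exact sub_eq_zero.1 (real_inner_self_nonpos.1 (by linarith))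
  have hJs : ∀ y, J xs ≤ J y + ⟪us, mApp A (y - xs)⟫ := by
    intro y
    have h := (hsaddle y us).2
    rw [hL, hL, hb, sub_self, inner_zero_right, add_zero] at h
    rwa [mApp_sub, hb]
  have hxsS : xs ∈ S := by
    rw [hS]
    refine ⟨hb, fun y hy => ?_⟩
    have h := hJs y
    rwa [mApp_sub, hy, hb, sub_self, inner_zero_right, add_zero] at h
  set Q := wNormSq (fun j => (σ j)⁻¹) with hQ
  set R := wNormSq (fun i => (γ i)⁻¹) with hR
  have hQ0 : ∀ y, 0 ≤ Q y := wNormSq_nonneg fun j => inv_pos.2 (hσ j)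
  have hR0 : ∀ v, 0 ≤ R v := wNormSq_nonneg fun i => inv_pos.2 (hγ i)
  have hgh0 : 0 ≤ gh := hgh ▸ norm_nonneg _
  set θ := opNorm (Matrix.diagonal (fun i => Real.sqrt (γ i)) * A *
      Matrix.diagonal (fun j => Real.sqrt (σ j))) with hθ
  have hcross : ∀ v w, |⟪v, mApp A w⟫| ≤ θ * Real.sqrt (R v) * Real.sqrt (Q w) :=
    abs_inner_mApp_le A hσ hγ
  have hcrossQ : ∀ v w, 2 * ⟪v, mApp A w⟫ ≤ R v + Q w := by
    intro v w
    have h := (le_abs_self _).trans (hcross v w)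
    nlinarith [Real.sq_sqrt (hR0 v), Real.sq_sqrt (hQ0 w), hR0 v,
      sq_nonneg (θ * Real.sqrt (R v) - Real.sqrt (Q w)), mul_nonneg hαpos.le (hR0 v)]
  have hcrossR : ∀ v w, -(2 * ⟪v, mApp A w⟫) ≤ (1 - α) * R v + Q w := by
    intro v w
    have h := (neg_le_abs _).trans (hcross v w)
    nlinarith [Real.sq_sqrt (hR0 v), Real.sq_sqrt (hQ0 w),
      sq_nonneg (θ * Real.sqrt (R v) - Real.sqrt (Q w))]
  have hnoise : ∀ v, ⟪v, b - bδ⟫ ≤ gh * δ * Real.sqrt (R v) := by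
    intro v
    have h1 := (le_abs_self _).trans (abs_inner_le_sqrt_wNormSq hγ v (b - bδ))
    have h2 : ‖mApp (Matrix.diagonal fun i => Real.sqrt (γ i)) (b - bδ)‖ ≤ gh * δ := by
      refine (norm_mApp_le _ _).trans ?_
      rw [← hgh, norm_sub_rev]
      exact mul_le_mul_of_nonneg_left hbδ hgh0
    calc _ ≤ _ := h1
      _ ≤ _ := mul_le_mul_of_nonneg_left h2 (Real.sqrt_nonneg _)
      _ = _ := by ring
  set w : ℕ → EuclideanSpace ℝ (Fin p) := fun k => pbar k - pp k with hw
  have hw0 : w 0 = 0 := by simp [hw, hinit]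
  have hw1 : ∀ k, w (k + 1) = x (k + 1) - pp k := by
    intro k
    simp only [hw, hpbar]
    abel
  have hdual : ∀ k, mApp (Matrix.diagonal fun i => (γ i)⁻¹) (u k - u (k + 1))
      = bδ - mApp A (pbar k) := by
    intro k
    ext i
    rw [hu k, mApp_diagonal_apply]
    simp only [PiLp.sub_apply, PiLp.add_apply, mApp_diagonal_apply]
    have := (hγ i).ne'
    field_simp
    ring
  have hstep : ∀ k, Q (pp (k + 1) - xs) + R (u (k + 1) - us)
        + 2 * ⟪u (k + 1) - us, mApp A (w (k + 1))⟫ + Q (w (k + 1))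
      ≤ Q (pp k - xs) + R (u k - us) + 2 * ⟪u k - us, mApp A (w k)⟫ + Q (w k)
        + e * δ ^ 2 + 2 * (gh * δ) * Real.sqrt (R (u (k + 1) - us)) := by
    intro k
    have hprox := hx k xs
    rw [inner_sub_left, inner_mApp_transpose] at hprox
    have hJ1 := hJs (x (k + 1))
    have hpol := two_mul_inner_diagonal_sub (fun j => (σ j)⁻¹) (pp k) xs (x (k + 1))
    have hpolu := two_mul_inner_diagonal_sub (fun i => (γ i)⁻¹) (u k) us (u (k + 1))
    rw [hdual, ← hR, real_inner_comm] at hpolu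
    rw [← hQ] at hpol
    have hT := hTstab (ε (k + 1)) (x (k + 1)) xs hxsS
    rw [← hpp] at hT
    have hQw : Q (pp k - x (k + 1)) = Q (w (k + 1)) := by
      rw [hw1]
      refine Finset.sum_congr rfl fun _ _ => ?_
      simp only [PiLp.sub_apply]
      ring
    have hc := hcrossQ (u k - u (k + 1)) (-w k)
    have hQneg : Q (-w k) = Q (w k) := by simp [hQ, wNormSq]
    have hn := hnoise (u (k + 1) - us)
    have hpb : mApp A (pbar k) = mApp A (pp k) + mApp A (w k) := by
      simp only [hw, mApp_sub]
      abel
    have hneg : mApp A (-w k) = -mApp A (w k) := map_neg _ _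
    rw [hneg, hQneg] at hc
    rw [hpb] at hpolu
    rw [hw1 k] at hQw ⊢
    simp only [mApp_sub, hb, inner_sub_left, inner_sub_right, inner_add_right, inner_neg_right]
      at *
    linarith
  have hV : Q (pp 0 - xs) + R (u 0 - us) + 2 * ⟪u 0 - us, mApp A (w 0)⟫ + Q (w 0) = 2 * V0 := by
    have h1 : mApp A (w 0) = 0 := by rw [hw0]; exact map_zero _
    have h2 : Q (w 0) = 0 := by simp [hw0, hQ, wNormSq]
    rw [h1, h2, inner_zero_right, hV0]
    ring
  have hmain := le_of_energy_recursion hαpos (mul_nonneg hgh0 hδ)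
    (mul_nonneg he (sq_nonneg δ)) (a := fun k => Real.sqrt (R (u k - us)))
    (E := fun k => Q (pp k - xs) + R (u k - us) + 2 * ⟪u k - us, mApp A (w k)⟫ + Q (w k))
    (fun k => Real.sqrt_nonneg _) hstep
    (fun k => by
      rw [Real.sq_sqrt (hR0 _)]
      linarith [hcrossR (u k - us) (w k), hQ0 (pp k - xs)]) N
  simp only [hV] at hmain
  convert hmain using 3
  · ring
  · ring_nf
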